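/- Every packed word u of length n ≥ 2 admits a unique decomposition u = u_1 ∨ u_2 ∨ … ∨ u_r (the operation ∨ applied left-nestedly) in which every factor u_i is a non-secable packed word. -/

import Mathlib

/-- The packed word of `u`: if the distinct letters of `u` are `b₁ < b₂ < … < b_r`,
then `pack u` is the image of `u` under the substitution `b_i ↦ i`. -/
def pack (u : List ℕ) : List ℕ :=
  u.map (fun x => (u.toFinset.filter (fun y => y ≤ x)).card)

/-- A word is packed if it is its own packed word. -/
def IsPacked (u : List ℕ) : Prop := pack u = u

/-- The largest letter of a word. -/
def maxL (u : List ℕ) : ℕ := u.foldr max 0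

/-- The packed word `u ∨ v` (lengths `k`, `l`): the first `k` letters are
`u_i + v₁ − 1` if `u_i ≤ u_k` and `u_i + max(v) − 1` if `u_i > u_k`, followed, for
`2 ≤ i ≤ l`, by `v_i` if `v_i < v₁` and `v_i + u_k − 1` if `v_i ≥ v₁`. -/
def veeP (u v : List ℕ) : List ℕ :=
  (u.map (fun x => if x ≤ u.getD (u.length - 1) 0 then x + v.getD 0 0 - 1
      else x + maxL v - 1)) ++
    ((v.drop 1).map (fun y => if y < v.getD 0 0 then y
      else y + u.getD (u.length - 1) 0 - 1))

/-- A finite set of naturals is an interval of integers (a set of consecutive values). -/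
def IsIntervalSet (s : Finset ℕ) : Prop :=
  ∀ a ∈ s, ∀ b ∈ s, ∀ c, a ≤ c → c ≤ b → c ∈ s

/-- The packed word `u` of length `n` is secable at `k` (for `2 ≤ k < n`):
(i) the set `{u₁,…,u_k}` is the union of an interval of integers with maximal value
`u_k` and another interval of integers that is either empty or has maximal value
`max u`; and (ii) `{u₁,…,u_k} ∩ {u_k,…,u_n} = {u_k}` (letters 1-indexed:
`u_k = u.getD (k-1) 0`). -/
def SecableAtP (u : List ℕ) (k : ℕ) : Prop :=
  (∃ s t : Finset ℕ, (u.take k).toFinset = s ∪ t ∧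
      IsIntervalSet s ∧ u.getD (k - 1) 0 ∈ s ∧ (∀ x ∈ s, x ≤ u.getD (k - 1) 0) ∧
      IsIntervalSet t ∧ (t = ∅ ∨ (maxL u ∈ t ∧ ∀ x ∈ t, x ≤ maxL u))) ∧
    (u.take k).toFinset ∩ (u.drop (k - 1)).toFinset = {u.getD (k - 1) 0}

/-- A packed word of length `n ≥ 2` is non-secable if it is secable at no `k` with
`2 ≤ k < n`. -/
def NonSecableP (u : List ℕ) : Prop :=
  2 ≤ u.length ∧ ∀ k, 2 ≤ k → k < u.length → ¬ SecableAtP u k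

/-- The letters of `u` are exactly `1, …, m`. -/
def HasLetters (u : List ℕ) (m : ℕ) : Prop := ∀ x, x ∈ u ↔ 1 ≤ x ∧ x ≤ m

theorem le_maxL {u : List ℕ} {x : ℕ} (hx : x ∈ u) : x ≤ maxL u := by
  induction u with
  | nil => simp at hx
  | cons y u ih =>
    simp only [maxL, List.foldr_cons] at ih ⊢
    rcases List.mem_cons.1 hx with rfl | h
    · exact le_max_left _ _
    · exact (ih h).trans (le_max_right _ _)

theorem maxL_mem {u : List ℕ} (hu : u ≠ []) : maxL u ∈ u := by
  induction u with
  | nil => simp at hu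
  | cons y u ih =>
    by_cases h : u = []
    · subst h; simp [maxL]
    · have := ih h
      simp only [maxL, List.foldr_cons] at this ⊢
      rcases max_choice y (u.foldr max 0) with h | h <;> rw [h] <;> simp [this]

theorem HasLetters.maxL_eq {u : List ℕ} {m : ℕ} (h : HasLetters u m) : maxL u = m := by
  by_cases hu : u = []
  · subst hu
    have := h m
    simp only [List.not_mem_nil, false_iff] at this
    simp only [maxL, List.foldr_nil]
    omega
  · have h1 := (h _).1 (maxL_mem hu)
    have h2 := le_maxL ((h m).2 ⟨by omega, le_rfl⟩)
    omega

theorem IsPacked.hasLetters {u : List ℕ} (hu : IsPacked u) : HasLetters u (maxL u) := by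
  have hsub : u.toFinset ⊆ Finset.Icc 1 u.toFinset.card := by
    intro x hx
    have hx' : x ∈ pack u := by rw [hu]; exact List.mem_toFinset.1 hx
    obtain ⟨y, hy, rfl⟩ := List.mem_map.1 hx'
    refine Finset.mem_Icc.2 ⟨Finset.card_pos.2 ⟨y, ?_⟩, Finset.card_filter_le _ _⟩
    simp [hy]
  have heq := Finset.eq_of_subset_of_card_le hsub (by simp)
  have h : HasLetters u u.toFinset.card := fun x => by
    rw [← Finset.mem_Icc, ← heq, List.mem_toFinset]
  rwa [h.maxL_eq]

theorem HasLetters.isPacked {u : List ℕ} {m : ℕ} (h : HasLetters u m) : IsPacked u := by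
  have hs : u.toFinset = Finset.Icc 1 m := by
    ext x; rw [List.mem_toFinset, Finset.mem_Icc, h x]
  unfold IsPacked pack
  conv_rhs => rw [← List.map_id u]
  refine List.map_congr_left fun x hx => ?_
  have hx' := (h x).1 hx
  have : (Finset.Icc 1 m).filter (fun y => y ≤ x) = Finset.Icc 1 x := by
    ext y; simp only [Finset.mem_filter, Finset.mem_Icc]; omega
  rw [hs, this]; simp

theorem pack_map_of_strictMonoOn {u : List ℕ} {f : ℕ → ℕ} (hf : StrictMonoOn f {x | x ∈ u}) :
    pack (u.map f) = pack u := by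
  unfold pack
  rw [List.map_map]
  refine List.map_congr_left fun x hx => ?_
  have : (u.map f).toFinset.filter (fun y => y ≤ f x)
      = (u.toFinset.filter (fun y => y ≤ x)).image f := by
    ext z
    simp only [Finset.mem_filter, List.mem_toFinset, List.mem_map, Finset.mem_image]
    constructor
    · rintro ⟨⟨y, hy, rfl⟩, hz⟩
      exact ⟨y, ⟨hy, (hf.le_iff_le hy hx).1 hz⟩, rfl⟩
    · rintro ⟨y, ⟨hy, hyx⟩, rfl⟩
      exact ⟨⟨y, hy, rfl⟩, (hf.le_iff_le hy hx).2 hyx⟩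
  simp only [Function.comp]
  rw [this, Finset.card_image_of_injOn]
  exact hf.injOn.mono fun y hy => by
    simp only [Finset.coe_filter, List.mem_toFinset, Set.mem_ofPred_eq] at hy ⊢
    exact hy.1

/-- The substitution applied to the left factor of `u ∨ v`, where `u` ends in `a`, `v` starts
with `b` and the largest letter of `v` is `N`. -/
def leftShift (a b N x : ℕ) : ℕ := if x ≤ a then x + b - 1 else x + N - 1

/-- The substitution applied to the right factor of `u ∨ v`, where `u` ends in `a` and `v`
starts with `b`. -/
def rightShift (a b y : ℕ) : ℕ := if y < b then y else y + a - 1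

theorem veeP_concat_cons (l r : List ℕ) (a b : ℕ) :
    veeP (l ++ [a]) (b :: r) = l.map (leftShift a b (maxL (b :: r))) ++
      (a + b - 1) :: r.map (rightShift a b) := by
  simp [veeP]
  rfl

theorem IsIntervalSet.exists_forall_mem_iff {s : Finset ℕ} {c : ℕ} (hs : IsIntervalSet s)
    (hc : c ∈ s) (hle : ∀ x ∈ s, x ≤ c) : ∃ d ≤ c, ∀ x, x ∈ s ↔ d ≤ x ∧ x ≤ c :=
  ⟨s.min' ⟨c, hc⟩, s.min'_le c hc, fun x =>
    ⟨fun hx => ⟨s.min'_le x hx, hle x hx⟩, fun hx => hs _ (s.min'_mem _) c hc x hx.1 hx.2⟩⟩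

/-- `l ++ c :: r`, with letters `1, …, m`, may be cut at the letter `c`: the letters of `l ++ [c]`
are those in `(p, c] ∪ (q, m]`, and `c` is the only one which occurs in `c :: r`. -/
def Cut (m : ℕ) (l : List ℕ) (c : ℕ) (r : List ℕ) : Prop :=
  ∃ p q, p < c ∧ c ≤ q ∧ q ≤ m ∧
    (∀ x, (x ∈ l ∨ x = c) ↔ (p < x ∧ x ≤ c) ∨ (q < x ∧ x ≤ m)) ∧
    ∀ x ∈ r, x ∈ l → x = c

theorem secableAtP_iff_cut {m : ℕ} {l r : List ℕ} {c : ℕ} (h : HasLetters (l ++ c :: r) m) :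
    SecableAtP (l ++ c :: r) (l.length + 1) ↔ Cut m l c r := by
  have htake : (l ++ c :: r).take (l.length + 1) = l ++ [c] := by simp [List.take_append]
  have hdrop : (l ++ c :: r).drop (l.length + 1 - 1) = c :: r := by simp
  have hget : (l ++ c :: r).getD (l.length + 1 - 1) 0 = c := by simp
  have hc := (h c).1 (by simp)
  unfold SecableAtP
  rw [htake, hdrop, hget, h.maxL_eq]
  have hset : (l ++ [c]).toFinset ∩ (c :: r).toFinset = {c} ↔ ∀ x ∈ r, x ∈ l → x = c := by
    constructor
    · intro hh x hr hl
      have : x ∈ (l ++ [c]).toFinset ∩ (c :: r).toFinset := by simp [hr, hl]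
      rw [hh] at this
      simpa using this
    · intro hh
      ext x
      simp only [Finset.mem_inter, List.mem_toFinset, List.mem_append, List.mem_cons,
        List.not_mem_nil, or_false, Finset.mem_singleton]
      constructor
      · rintro ⟨h1 | h1, h2 | h2⟩ <;> first | assumption | exact hh x h2 h1
      · rintro rfl; simp
  rw [hset]
  have hm : ∀ x, (x ∈ l ∨ x = c) → 1 ≤ x ∧ x ≤ m := fun x hx => (h x).1 (by
    rcases hx with hx | rfl <;> simp [*])
  constructor
  · rintro ⟨⟨s, t, hst, hs, hcs, hsc, ht, htm⟩, hr⟩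
    have hmem : ∀ x, (x ∈ l ∨ x = c) ↔ x ∈ s ∨ x ∈ t := fun x => by
      rw [← Finset.mem_union, ← hst]; simp [or_comm]
    obtain ⟨d, hdc, hd⟩ := hs.exists_forall_mem_iff hcs hsc
    obtain ⟨e, hem, he⟩ : ∃ e ≤ m + 1, ∀ x, x ∈ t ↔ e ≤ x ∧ x ≤ m := by
      rcases htm with rfl | ⟨hmt, htm⟩
      · exact ⟨m + 1, le_rfl, fun x => by simp only [Finset.notMem_empty, false_iff]; omega⟩
      · obtain ⟨e, hem, he⟩ := ht.exists_forall_mem_iff hmt htm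
        exact ⟨e, by omega, he⟩
    have hd1 := hm d ((hmem d).2 (Or.inl ((hd d).2 ⟨le_rfl, hdc⟩)))
    have he1 : 1 ≤ e := by
      by_contra hlt
      have := hm e ((hmem e).2 (Or.inr ((he e).2 ⟨le_rfl, by omega⟩)))
      omega
    refine ⟨min d e - 1, max (e - 1) c, by omega, by omega, by omega, fun x => ?_, hr⟩
    rw [hmem, hd, he]
    omega
  · rintro ⟨p, q, hpc, hcq, hqm, hmem, hr⟩
    refine ⟨⟨Finset.Ioc p c, Finset.Ioc q m, ?_, ?_, ?_, ?_, ?_, ?_⟩, hr⟩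
    · ext x
      have := hmem x
      simpa [or_comm] using this
    · intro x hx y hy z; simp only [Finset.mem_Ioc] at *; omega
    · simpa using hpc
    · intro x hx; simp only [Finset.mem_Ioc] at *; omega
    · intro x hx y hy z; simp only [Finset.mem_Ioc] at *; omega
    · rcases hqm.eq_or_lt with rfl | hlt
      · left; simp
      · right; exact ⟨by simpa using hlt, fun x hx => (Finset.mem_Ioc.1 hx).2⟩

theorem hasLetters_veeP {l r : List ℕ} {a b A N : ℕ} (hw : HasLetters (l ++ [a]) A)
    (hv : HasLetters (b :: r) N) :
    HasLetters (l.map (leftShift a b N) ++ (a + b - 1) :: r.map (rightShift a b)) (A + N - 1) := by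
  have ha := (hw a).1 (by simp)
  have hb := (hv b).1 (by simp)
  intro x
  simp only [HasLetters, List.mem_append, List.mem_cons, List.not_mem_nil, or_false] at hw hv
  simp only [List.mem_append, List.mem_map, List.mem_cons]
  constructor
  · rintro (⟨y, hy, rfl⟩ | rfl | ⟨y, hy, rfl⟩)
    · have := (hw y).1 (Or.inl hy)
      unfold leftShift; split_ifs <;> omega
    · omega
    · have := (hv y).1 (Or.inr hy)
      unfold rightShift; split_ifs <;> omega
  · intro hx
    by_cases hxe : x = a + b - 1
    · exact Or.inr (Or.inl hxe)
    by_cases h1 : x < b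
    · refine Or.inr (Or.inr ⟨x, ?_, by simp [rightShift, h1]⟩)
      exact ((hv x).2 (by omega)).resolve_left (by omega)
    by_cases h2 : x < a + b
    · refine Or.inl ⟨x + 1 - b, ?_, by unfold leftShift; split_ifs <;> omega⟩
      exact ((hw _).2 (by omega)).resolve_right (by omega)
    by_cases h3 : x < N + a
    · refine Or.inr (Or.inr ⟨x + 1 - a, ?_, by unfold rightShift; split_ifs <;> omega⟩)
      exact ((hv _).2 (by omega)).resolve_left (by omega)
    · refine Or.inl ⟨x + 1 - N, ?_, by unfold leftShift; split_ifs <;> omega⟩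
      exact ((hw _).2 (by omega)).resolve_right (by omega)

theorem mem_map_leftShift_or_eq {l : List ℕ} {a b A N : ℕ} (hw : HasLetters (l ++ [a]) A)
    (hb : 1 ≤ b) (hbN : b ≤ N) (x : ℕ) :
    (x ∈ l.map (leftShift a b N) ∨ x = a + b - 1) ↔
      (b - 1 < x ∧ x ≤ a + b - 1) ∨ (a + N - 1 < x ∧ x ≤ A + N - 1) := by
  have ha := (hw a).1 (by simp)
  simp only [HasLetters, List.mem_append, List.mem_cons, List.not_mem_nil, or_false] at hw
  rw [List.mem_map]
  constructor
  · rintro (⟨y, hy, rfl⟩ | rfl)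
    · have := (hw y).1 (Or.inl hy)
      unfold leftShift; split_ifs <;> omega
    · omega
  · intro hx
    by_cases hxe : x = a + b - 1
    · exact Or.inr hxe
    by_cases h2 : x < a + b
    · refine Or.inl ⟨x + 1 - b, ?_, by unfold leftShift; split_ifs <;> omega⟩
      exact ((hw _).2 (by omega)).resolve_right (by omega)
    · refine Or.inl ⟨x + 1 - N, ?_, by unfold leftShift; split_ifs <;> omega⟩
      exact ((hw _).2 (by omega)).resolve_right (by omega)

theorem cut_veeP {l r : List ℕ} {a b A N : ℕ} (hw : HasLetters (l ++ [a]) A)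
    (hv : HasLetters (b :: r) N) :
    Cut (A + N - 1) (l.map (leftShift a b N)) (a + b - 1) (r.map (rightShift a b)) := by
  have ha := (hw a).1 (by simp)
  have hb := (hv b).1 (by simp)
  have hmem := mem_map_leftShift_or_eq hw hb.1 hb.2
  refine ⟨b - 1, a + N - 1, by omega, by omega, by omega, hmem, fun x hx hxl => ?_⟩
  have h1 := (hmem x).1 (Or.inl hxl)
  obtain ⟨y, hy, rfl⟩ := List.mem_map.1 hx
  have := (hv y).1 (by simp [hy])
  unfold rightShift at h1 ⊢
  split_ifs at h1 ⊢ <;> omega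

theorem Cut.exists_veeP {l r : List ℕ} {c m : ℕ} (hu : HasLetters (l ++ c :: r) m)
    (h : Cut m l c r) : ∃ l' a b r', l'.length = l.length ∧ r'.length = r.length ∧
      IsPacked (l' ++ [a]) ∧ IsPacked (b :: r') ∧ veeP (l' ++ [a]) (b :: r') = l ++ c :: r := by
  obtain ⟨p, q, hpc, hcq, hqm, hmem, hr⟩ := h
  simp only [HasLetters, List.mem_append, List.mem_cons] at hu
  have hl : ∀ x ∈ l, (p < x ∧ x ≤ c) ∨ (q < x ∧ x ≤ m) := fun x hx => (hmem x).1 (Or.inl hx)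
  have hr' : ∀ x ∈ r, (1 ≤ x ∧ x ≤ p) ∨ (c ≤ x ∧ x ≤ q) := fun x hx => by
    have h1 := (hu x).1 (by simp [hx])
    by_contra h2
    have h3 := (hmem x).2 (by omega)
    have : x = c := h3.elim (hr x hx) id
    omega
  have hr'' : ∀ x, (1 ≤ x ∧ x ≤ p) ∨ (c < x ∧ x ≤ q) → x ∈ r := fun x hx => by
    rcases (hu x).2 (by omega) with h1 | h1 | h1
    · have := hl x h1; omega
    · omega
    · exact h1
  have hw : HasLetters (l.map (fun x => if x ≤ c then x - p else x - q + (c - p)) ++ [c - p])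
      (m - q + (c - p)) := by
    intro x
    simp only [List.mem_append, List.mem_map, List.mem_cons, List.not_mem_nil, or_false]
    constructor
    · rintro (⟨y, hy, rfl⟩ | rfl)
      · have := hl y hy
        split_ifs <;> omega
      · omega
    · intro hx
      by_cases h0 : x = c - p
      · exact Or.inr h0
      by_cases h1 : x ≤ c - p
      · refine Or.inl ⟨x + p, ((hmem _).2 (by omega)).resolve_right (by omega), ?_⟩
        split_ifs <;> omega
      · refine Or.inl ⟨x - (c - p) + q, ((hmem _).2 (by omega)).resolve_right (by omega), ?_⟩
        split_ifs <;> omega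
  have hv : HasLetters ((p + 1) :: r.map (fun y => if y ≤ p then y else y - (c - p - 1)))
      (q - (c - p - 1)) := by
    intro x
    simp only [List.mem_cons, List.mem_map]
    constructor
    · rintro (rfl | ⟨y, hy, rfl⟩)
      · omega
      · have := hr' y hy
        split_ifs <;> omega
    · intro hx
      by_cases h0 : x = p + 1
      · exact Or.inl h0
      by_cases h1 : x ≤ p
      · exact Or.inr ⟨x, hr'' x (by omega), by simp [h1]⟩
      · refine Or.inr ⟨x + (c - p - 1), hr'' _ (by omega), ?_⟩
        split_ifs <;> omega
  refine ⟨_, _, _, _, List.length_map _, List.length_map _, hw.isPacked, hv.isPacked, ?_⟩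
  rw [veeP_concat_cons, hv.maxL_eq, List.map_map, List.map_map]
  congr 1
  · conv_rhs => rw [← List.map_id l]
    refine List.map_congr_left fun x hx => ?_
    have := hl x hx
    simp only [Function.comp, leftShift, id]
    split_ifs <;> omega
  · congr 1
    · omega
    · conv_rhs => rw [← List.map_id r]
      refine List.map_congr_left fun x hx => ?_
      have := hr' x hx
      simp only [Function.comp, rightShift, id]
      split_ifs <;> omega

theorem rightShift_strictMono {a b : ℕ} (ha : 1 ≤ a) : StrictMono (rightShift a b) := by
  intro x y hxy
  unfold rightShift
  split_ifs <;> omega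

theorem cut_veeP_iff {l l' r : List ℕ} {a b c A N : ℕ} (hw : HasLetters (l ++ [a]) A)
    (hv : HasLetters (b :: l' ++ c :: r) N) :
    Cut (A + N - 1) (l.map (leftShift a b N) ++ (a + b - 1) :: l'.map (rightShift a b))
      (rightShift a b c) (r.map (rightShift a b)) ↔ Cut N (b :: l') c r := by
  have ha := (hw a).1 (by simp)
  have hb := (hv b).1 (by simp)
  have hc := (hv c).1 (by simp)
  have hmem := mem_map_leftShift_or_eq hw hb.1 hb.2
  have hmono := rightShift_strictMono (b := b) ha.1
  have hinj : ∀ (t : List ℕ) y, rightShift a b y ∈ t.map (rightShift a b) ↔ y ∈ t := fun t y =>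
    List.mem_map_of_injective hmono.injective
  have hl' : ∀ x ∈ l', 1 ≤ x ∧ x ≤ N := fun x hx => (hv x).1 (by simp [hx])
  have hr' : ∀ x ∈ r, 1 ≤ x ∧ x ≤ N := fun x hx => (hv x).1 (by simp [hx])
  have hmem' : ∀ x, (x ∈ l.map (leftShift a b N) ++ (a + b - 1) :: l'.map (rightShift a b)) ↔
      ((b - 1 < x ∧ x ≤ a + b - 1) ∨ (a + N - 1 < x ∧ x ≤ A + N - 1)) ∨
        x ∈ l'.map (rightShift a b) := fun x => by
    rw [← hmem]; simp only [List.mem_append, List.mem_cons, or_assoc]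
  have hval : ∀ y, (y < b ∧ rightShift a b y = y) ∨ (b ≤ y ∧ rightShift a b y = y + a - 1) :=
    fun y => by unfold rightShift; split_ifs <;> omega
  have hsurj : ∀ x, x < b ∨ a + b - 1 ≤ x → ∃ y, rightShift a b y = x := fun x hx => by
    rcases hx with hx | hx
    · exact ⟨x, by simp [rightShift, hx]⟩
    · exact ⟨x + 1 - a, by unfold rightShift; split_ifs <;> omega⟩
  unfold Cut
  simp only [hmem']
  constructor
  · rintro ⟨p, q, hpc, hcq, hqm, hX, hR⟩
    obtain ⟨p, rfl⟩ := hsurj p (by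
      have := hX p
      by_contra hp
      omega)
    obtain ⟨q, rfl⟩ := hsurj q (by
      have := hX q
      have := hval c
      by_contra hq
      omega)
    have hXb := hX (a + b - 1)
    have hqN : q ≤ N := by
      have h1 := hX (rightShift a b q)
      have h2 := hval q
      have h3 := hval c
      by_contra hlt
      omega
    refine ⟨p, q, hmono.lt_iff_lt.1 hpc, hmono.le_iff_le.1 hcq, hqN, fun y => ?_, fun y hy hyl => ?_⟩
    · have h1 := hX (rightShift a b y)
      rw [hinj, hmono.injective.eq_iff, hmono.lt_iff_lt, hmono.lt_iff_lt, hmono.le_iff_le] at h1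
      have h2 := hval y
      have h3 := hl' y
      simp only [List.mem_cons]
      by_cases hyN : y ≤ N
      · have h4 : rightShift a b y ≤ A + N - 1 := by omega
        have h5 : (b - 1 < rightShift a b y ∧ rightShift a b y ≤ a + b - 1) ↔ y = b := by omega
        have h6 : ¬ a + N - 1 < rightShift a b y := by omega
        simpa [h4, h5, h6, hyN] using h1
      · have h4 : y ∉ l' := fun h => hyN (h3 h).2
        simp only [h4, or_false]
        have := hmono.le_iff_le.1 hcq
        omega
    · refine hmono.injective (hR _ ((hinj _ _).2 hy) ?_)
      rcases List.mem_cons.1 hyl with rfl | h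
      · left; left
        have := hval y
        omega
      · exact Or.inr ((hinj _ _).2 h)
  · rintro ⟨p, q, hpc, hcq, hqm, hX, hR⟩
    have hXb := hX b
    simp only [List.mem_cons, true_or, true_iff] at hXb
    refine ⟨rightShift a b p, rightShift a b q, hmono hpc, hmono.monotone hcq, ?_, fun x => ?_, ?_⟩
    · have := hval q; omega
    · by_cases hx : x < b ∨ a + b - 1 ≤ x
      · obtain ⟨y, rfl⟩ := hsurj x hx
        have h1 := hX y
        rw [hinj, hmono.injective.eq_iff, hmono.lt_iff_lt, hmono.lt_iff_lt, hmono.le_iff_le]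
        have h2 := hval y
        have h3 := hl' y
        simp only [List.mem_cons] at h1
        by_cases hyN : y ≤ N
        · have h4 : rightShift a b y ≤ A + N - 1 := by omega
          have h5 : (b - 1 < rightShift a b y ∧ rightShift a b y ≤ a + b - 1) ↔ y = b := by omega
          have h6 : ¬ a + N - 1 < rightShift a b y := by omega
          simpa [h4, h5, h6, hyN] using h1
        · have h4 : y ∉ l' := fun h => hyN (h3 h).2
          simp only [h4, or_false]
          omega
      · have h1 := hval p
        have h2 := hval q
        have h3 := hval c
        have h4 : b - 1 < x ∧ x ≤ a + b - 1 := by omega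
        simp only [h4, and_self, true_or, true_iff]
        omega
    · intro x hx hxl
      obtain ⟨y, hy, rfl⟩ := List.mem_map.1 hx
      rw [hinj] at hxl
      have h2 := hval y
      have h3 := hr' y hy
      refine congrArg _ (hR y hy (List.mem_cons.2 ?_))
      rcases hxl with h | h
      · left; omega
      · exact Or.inr h

theorem nonSecableP_iff {u : List ℕ} {m : ℕ} (hu : HasLetters u m) :
    NonSecableP u ↔ 2 ≤ u.length ∧
      ∀ l c r, u = l ++ c :: r → l ≠ [] → r ≠ [] → ¬ Cut m l c r := by
  refine and_congr_right fun _ => ⟨fun h l c r hlr hl hr hcut => ?_, fun h k hk hku hs => ?_⟩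
  · subst hlr
    have := List.length_pos_of_ne_nil hl
    have := List.length_pos_of_ne_nil hr
    exact h (l.length + 1) (by omega) (by simp; omega) ((secableAtP_iff_cut hu).2 hcut)
  · have hlt : k - 1 < u.length := by omega
    have hsplit : u = u.take (k - 1) ++ u[k - 1] :: u.drop k := by
      conv_lhs => rw [← List.take_append_drop (k - 1) u, List.drop_eq_getElem_cons hlt]
      rw [show k - 1 + 1 = k by omega]
    have hlen : (u.take (k - 1)).length + 1 = k := by simp; omega
    refine h _ _ _ hsplit (fun h0 => ?_) (fun h0 => ?_) ((secableAtP_iff_cut (hsplit ▸ hu)).1 ?_)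
    · rw [h0] at hlen; simp at hlen; omega
    · have := congrArg List.length h0
      simp at this; omega
    · rw [← hsplit, hlen]; exact hs

theorem exists_concat_of_two_le {w : List ℕ} (h : 2 ≤ w.length) :
    ∃ l a, w = l ++ [a] ∧ l ≠ [] := by
  rcases List.eq_nil_or_concat w with rfl | ⟨l, a, rfl⟩
  · simp at h
  · refine ⟨l, a, by simp, ?_⟩
    rintro rfl
    simp at h

theorem exists_cons_of_two_le {v : List ℕ} (h : 2 ≤ v.length) :
    ∃ b r, v = b :: r ∧ r ≠ [] := by
  match v, h with
  | b :: c :: r, _ => exact ⟨b, c :: r, rfl, by simp⟩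

theorem isPacked_veeP {w v : List ℕ} (hw : IsPacked w) (hv : IsPacked v) (hw2 : 2 ≤ w.length)
    (hv2 : 2 ≤ v.length) : IsPacked (veeP w v) := by
  obtain ⟨l, a, rfl, -⟩ := exists_concat_of_two_le hw2
  obtain ⟨b, r, rfl, -⟩ := exists_cons_of_two_le hv2
  rw [veeP_concat_cons]
  exact (hasLetters_veeP hw.hasLetters hv.hasLetters).isPacked

theorem length_veeP (w v : List ℕ) : (veeP w v).length = w.length + (v.length - 1) := by
  simp [veeP]

theorem not_nonSecableP_veeP {w v : List ℕ} (hw : IsPacked w) (hv : IsPacked v)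
    (hw2 : 2 ≤ w.length) (hv2 : 2 ≤ v.length) : ¬ NonSecableP (veeP w v) := by
  obtain ⟨l, a, rfl, hl⟩ := exists_concat_of_two_le hw2
  obtain ⟨b, r, rfl, hr⟩ := exists_cons_of_two_le hv2
  rw [veeP_concat_cons, nonSecableP_iff (hasLetters_veeP hw.hasLetters hv.hasLetters)]
  exact fun h => h.2 _ _ _ rfl (by simpa) (by simpa) (cut_veeP hw.hasLetters hv.hasLetters)

theorem length_le_of_veeP_eq {w w' v v' : List ℕ} (hw : IsPacked w) (hw' : IsPacked w')
    (hv : IsPacked v) (hv' : IsPacked v') (hw2 : 2 ≤ w.length) (hw2' : 2 ≤ w'.length)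
    (hv2' : 2 ≤ v'.length) (hns : NonSecableP v) (h : veeP w v = veeP w' v') :
    w'.length ≤ w.length := by
  by_contra! hlt
  rw [nonSecableP_iff hv.hasLetters] at hns
  obtain ⟨l, a, rfl, hl⟩ := exists_concat_of_two_le hw2
  obtain ⟨l', a', rfl, hl'⟩ := exists_concat_of_two_le hw2'
  obtain ⟨b, r, rfl, hr⟩ := exists_cons_of_two_le hns.1
  obtain ⟨b', r', rfl, hr'⟩ := exists_cons_of_two_le hv2'
  have hcut := cut_veeP hw'.hasLetters hv'.hasLetters
  have hm := (hasLetters_veeP hw'.hasLetters hv'.hasLetters).maxL_eq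
  rw [← veeP_concat_cons, ← h, veeP_concat_cons,
    (hasLetters_veeP hw.hasLetters hv.hasLetters).maxL_eq] at hm
  rw [← hm] at hcut
  rw [veeP_concat_cons, veeP_concat_cons] at h
  simp only [List.length_append, List.length_cons, List.length_nil] at hlt
  rw [List.append_eq_append_iff] at h
  rcases h with ⟨x, hx1, hx2⟩ | ⟨x, hx1, hx2⟩
  · rcases x with _ | ⟨x0, x⟩
    · have := congrArg List.length hx1
      simp at this; omega
    · rw [List.cons_append, List.cons.injEq] at hx2
      obtain ⟨rfl, hx2⟩ := hx2
      obtain ⟨l₃, r₃, rfl, rfl, h3⟩ := List.map_eq_append_iff.1 hx2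
      obtain ⟨c, r₂, rfl, h4, h5⟩ := List.map_eq_cons_iff.1 h3
      rw [hx1, ← h4, ← h5] at hcut
      refine hns.2 (b :: l₃) c r₂ rfl (by simp) ?_
        ((cut_veeP_iff hw.hasLetters hv.hasLetters).1 hcut)
      rintro rfl
      simp at h5
      exact hr' h5
  · have := congrArg List.length hx1
    simp at this; omega

theorem pack_take_drop_veeP (w v : List ℕ) (hw2 : 2 ≤ w.length) (hv2 : 2 ≤ v.length) (hw : IsPacked w)
    (hv : IsPacked v) : pack ((veeP w v).take w.length) = w ∧
      pack ((veeP w v).drop (w.length - 1)) = v := by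
  obtain ⟨l, a, rfl, hl⟩ := exists_concat_of_two_le hw2
  obtain ⟨b, r, rfl, hr⟩ := exists_cons_of_two_le hv2
  have ha := (hw.hasLetters a).1 (by simp)
  have hb := (hv.hasLetters b).1 (by simp)
  have h1 : leftShift a b (maxL (b :: r)) a = a + b - 1 := by simp [leftShift]
  have h2 : rightShift a b b = a + b - 1 := by simp [rightShift, add_comm]
  have h3 : veeP (l ++ [a]) (b :: r) =
      (l ++ [a]).map (leftShift a b (maxL (b :: r))) ++ r.map (rightShift a b) := by
    rw [veeP_concat_cons]; simp [h1]
  have h4 : veeP (l ++ [a]) (b :: r) =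
      l.map (leftShift a b (maxL (b :: r))) ++ (b :: r).map (rightShift a b) := by
    rw [veeP_concat_cons]; simp [h2]
  constructor
  · rw [h3, List.take_left' (by simp), pack_map_of_strictMonoOn, hw]
    intro x hx y hy hxy
    have := (hw.hasLetters x).1 hx
    unfold leftShift
    split_ifs <;> omega
  · rw [h4, List.drop_left' (by simp), pack_map_of_strictMonoOn, hv]
    exact (rightShift_strictMono ha.1).strictMonoOn _

theorem veeP_inj {w w' v v' : List ℕ} (hw : IsPacked w) (hw' : IsPacked w')
    (hv : IsPacked v) (hv' : IsPacked v') (hw2 : 2 ≤ w.length) (hw2' : 2 ≤ w'.length)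
    (hns : NonSecableP v) (hns' : NonSecableP v') (h : veeP w v = veeP w' v') :
    w = w' ∧ v = v' := by
  have hlen := (length_le_of_veeP_eq hw' hw hv' hv hw2' hw2 hns.1 hns' h.symm).antisymm
    (length_le_of_veeP_eq hw hw' hv hv' hw2 hw2' hns'.1 hns h)
  obtain ⟨h1, h2⟩ := pack_take_drop_veeP w v hw2 hns.1 hw hv
  obtain ⟨h3, h4⟩ := pack_take_drop_veeP w' v' hw2' hns'.1 hw' hv'
  rw [h, hlen] at h1 h2
  exact ⟨h1.symm.trans h3, h2.symm.trans h4⟩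

theorem foldl_veeP_isPacked (L : List (List ℕ)) {w : List ℕ} (hw : IsPacked w)
    (hw2 : 2 ≤ w.length) (hL : ∀ v ∈ L, IsPacked v ∧ NonSecableP v) :
    IsPacked (L.foldl veeP w) ∧ 2 ≤ (L.foldl veeP w).length := by
  induction L generalizing w with
  | nil => exact ⟨hw, hw2⟩
  | cons v L ih =>
    have hv := hL v (by simp)
    refine ih (isPacked_veeP hw hv.1 hw2 hv.2.1) ?_ fun x hx => hL x (by simp [hx])
    rw [length_veeP]; omega

theorem exists_veeP_nonSecableP {u : List ℕ} (hu : IsPacked u) (h2 : 2 ≤ u.length)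
    (h : ¬ NonSecableP u) : ∃ w v, IsPacked w ∧ 2 ≤ w.length ∧ IsPacked v ∧ NonSecableP v ∧
      veeP w v = u := by
  have hcut : ∃ k l c r, k = r.length ∧ u = l ++ c :: r ∧ l ≠ [] ∧ r ≠ [] ∧
      Cut (maxL u) l c r := by
    rw [nonSecableP_iff hu.hasLetters] at h
    push Not at h
    obtain ⟨l, c, r, rfl, hl, hr, hc⟩ := h h2
    exact ⟨r.length, l, c, r, rfl, rfl, hl, hr, hc⟩
  classical
  have hmin : ∀ {k}, k < Nat.find hcut → _ := fun {_} => Nat.find_min hcut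
  obtain ⟨l, c, r, hk, hlr, hl, hr, hc⟩ := Nat.find_spec hcut
  obtain ⟨l', a, b, r', hll, hrl, hw, hv, hwv⟩ := hc.exists_veeP (hlr ▸ hu.hasLetters)
  rw [← hlr] at hwv
  have hl0 := List.length_pos_of_ne_nil hl
  have hr0 := List.length_pos_of_ne_nil hr
  refine ⟨l' ++ [a], b :: r', hw, by simp; omega, hv, ?_, hwv⟩
  rw [nonSecableP_iff hv.hasLetters]
  refine ⟨by simp; omega, ?_⟩
  rintro (_ | ⟨b', l₃⟩) c₂ r₂ h3 hl3 hr2 hcut2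
  · exact hl3 rfl
  · rw [List.cons_append, List.cons.injEq] at h3
    obtain ⟨rfl, rfl⟩ := h3
    have hcut3 := (cut_veeP_iff hw.hasLetters hv.hasLetters).2 hcut2
    have hm := (hasLetters_veeP hw.hasLetters hv.hasLetters).maxL_eq
    rw [veeP_concat_cons] at hwv
    rw [hwv] at hm
    refine hmin ?_ ⟨_, _, _, rfl, ?_, ?_, ?_, hm ▸ hcut3⟩
    · simp only [List.length_append, List.length_cons, List.length_map] at hrl ⊢
      omega
    · rw [← hwv]; simp
    · simp
    · simpa using hr2

/-- every packed word `u` of length `n ≥ 2` admits a unique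
decomposition `u = u₁ ∨ u₂ ∨ … ∨ u_r` (the operation `∨` applied left-nestedly,
encoded as the pair `(u₁, [u₂,…,u_r])` and a left fold) in which every factor `u_i`
is a non-secable packed word. -/
theorem unique_veeP_factorization (u : List ℕ) (hu : IsPacked u) (h2 : 2 ≤ u.length) :
    ∃! p : List ℕ × List (List ℕ),
      (IsPacked p.1 ∧ NonSecableP p.1) ∧
      (∀ w ∈ p.2, IsPacked w ∧ NonSecableP w) ∧
      p.2.foldl veeP p.1 = u := by
  induction hn : u.length using Nat.strong_induction_on generalizing u with
  | _ n ih =>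
  subst hn
  by_cases hns : NonSecableP u
  · refine ⟨(u, []), ⟨⟨hu, hns⟩, by simp, rfl⟩, ?_⟩
    rintro ⟨w, L⟩ ⟨hw, hL, rfl⟩
    rcases List.eq_nil_or_concat L with rfl | ⟨L, v, rfl⟩
    · rfl
    · have hv := hL v (by simp)
      obtain ⟨h3, h4⟩ := foldl_veeP_isPacked L hw.1 hw.2.1 fun x hx => hL x (by simp [hx])
      simp only [List.concat_eq_append, List.foldl_concat] at hns
      exact absurd hns (not_nonSecableP_veeP h3 hv.1 h4 hv.2.1)
  · obtain ⟨w, v, hw, hw2, hv, hvns, rfl⟩ := exists_veeP_nonSecableP hu h2 hns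
    have hv2 := hvns.1
    obtain ⟨⟨w₁, L⟩, ⟨hp1, hp2, hp3⟩, huniq⟩ := ih w.length (by rw [length_veeP]; omega) w hw hw2 rfl
    refine ⟨(w₁, L ++ [v]), ⟨hp1, ?_, ?_⟩, ?_⟩
    · intro x hx
      rcases List.mem_append.1 hx with hx | hx
      · exact hp2 x hx
      · rw [List.mem_singleton.1 hx]; exact ⟨hv, hvns⟩
    · simp only [List.foldl_append, List.foldl_cons, List.foldl_nil] at hp3 ⊢
      rw [hp3]
    · rintro ⟨w', L'⟩ ⟨hw', hL', h⟩
      rcases List.eq_nil_or_concat L' with rfl | ⟨L', v', rfl⟩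
      · simp only [List.foldl_nil] at h
        subst h
        exact absurd hw'.2 hns
      · have hv' := hL' v' (by simp)
        have hL'' : ∀ x ∈ L', IsPacked x ∧ NonSecableP x := fun x hx => hL' x (by simp [hx])
        obtain ⟨h3, h4⟩ := foldl_veeP_isPacked L' hw'.1 hw'.2.1 hL''
        simp only [List.concat_eq_append, List.foldl_concat] at h
        obtain ⟨h5, rfl⟩ := veeP_inj h3 hw hv'.1 hv h4 hw2 hv'.2 hvns h
        have := huniq (w', L') ⟨hw', hL'', h5⟩
        simp only [Prod.mk.injEq] at this ⊢
        obtain ⟨rfl, rfl⟩ := this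
        simp
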